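/- Let Q_i(x₁,…,x₅) = x₁^i + ⋯ + x₅^i, P = 1 + (917/500)Q₁ − (281/50)Q₁² − (41/25)Q₂ + (287/100)Q₁³ + (191/100)Q₁Q₂ − (81/250)Q₃, and let F : ℝ⁵ → ℝ equal P on {x ∈ [0,∞)⁵ : Σ x_i ≤ 1} and 0 elsewhere. Take k = 5, θ = 1 and η = 10^{−10}. Then −Σ_{m=1}^5 L₅^{(m)}(F) + (1/4)·log((1−10^{−10})/10^{−10})·Σ_{m=1}^5 J₅^{(m)}(F) + Σ_{m=1}^5 M₅^{(m)}(F) − I₅(F) > 0. -/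

import Mathlib

open scoped Classical

/-- The unit box `[0,1]^k`. -/
def unitBox (k : ℕ) : Set (Fin k → ℝ) := Set.univ.pi fun _ => Set.Icc (0 : ℝ) 1

/-- `I_k(F) = ∫_{[0,1]^k} F(t)² dt`. -/
noncomputable def Ik (k : ℕ) (F : (Fin k → ℝ) → ℝ) : ℝ :=
  ∫ x in unitBox k, (F x) ^ 2

/-- `J_k^{(m)}(F) = ∫_{[0,1]^{k-1}} (∫_0^1 F dt_m)² dt_{≠m}` (written as an integral over
`[0,1]^k`, which gives the same value since the integrand does not depend on `t_m`). -/
noncomputable def Jk (k : ℕ) (m : Fin k) (F : (Fin k → ℝ) → ℝ) : ℝ :=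
  ∫ x in unitBox k, (∫ s in (0 : ℝ)..1, F (Function.update x m s)) ^ 2

/-- The modified function `F_m(u; ξ)`, with `u_m` replaced by
`ξ/c + ((c - ξ)/c)·u_m`, where `c = θ/2`. -/
noncomputable def Fmod (k : ℕ) (c : ℝ) (m : Fin k) (F : (Fin k → ℝ) → ℝ) (ξ : ℝ)
    (x : Fin k → ℝ) : ℝ :=
  F (Function.update x m (ξ / c + ((c - ξ) / c) * x m))

/-- `L_k^{[m]}(ξ)`. -/
noncomputable def Lbrk (k : ℕ) (c : ℝ) (m : Fin k) (F : (Fin k → ℝ) → ℝ) (ξ : ℝ) : ℝ :=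
  ∫ x in unitBox k,
    (∫ s in (0 : ℝ)..1, Fmod k c m F ξ (Function.update x m s)) *
      (∫ s in (0 : ℝ)..1, F (Function.update x m s))

/-- `M_k^{[m]}(ξ)`. -/
noncomputable def Mbrk (k : ℕ) (c : ℝ) (m : Fin k) (F : (Fin k → ℝ) → ℝ) (ξ : ℝ) : ℝ :=
  ∫ x in unitBox k,
    (∫ s in (0 : ℝ)..1, Fmod k c m F ξ (Function.update x m s)) ^ 2

/-- `L_k^{(m)}(F) = ∫_η^c ((c-ξ)/(1-ξ)) L_k^{[m]}(ξ) dξ/ξ`, with `c = θ/2`. -/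
noncomputable def Lk (k : ℕ) (c η : ℝ) (m : Fin k) (F : (Fin k → ℝ) → ℝ) : ℝ :=
  ∫ ξ in η..c, (c - ξ) / (1 - ξ) * Lbrk k c m F ξ / ξ

/-- `M_k^{(m)}(F) = ∫_η^c ((c-ξ)²/(1-ξ)) M_k^{[m]}(ξ) dξ/ξ`, with `c = θ/2`. -/
noncomputable def Mk (k : ℕ) (c η : ℝ) (m : Fin k) (F : (Fin k → ℝ) → ℝ) : ℝ :=
  ∫ ξ in η..c, (c - ξ) ^ 2 / (1 - ξ) * Mbrk k c m F ξ / ξ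

/-- The power sums `Q_i(x₁,…,x₅) = x₁^i + ⋯ + x₅^i`. -/
noncomputable def Qpow (i : ℕ) (x : Fin 5 → ℝ) : ℝ := ∑ j, x j ^ i

/-- The polynomial `P` from the proof of Theorem 1.4. -/
noncomputable def Ppoly (x : Fin 5 → ℝ) : ℝ :=
  1 + 917 / 500 * Qpow 1 x - 281 / 50 * Qpow 1 x ^ 2 - 41 / 25 * Qpow 2 x
    + 287 / 100 * Qpow 1 x ^ 3 + 191 / 100 * Qpow 1 x * Qpow 2 x - 81 / 250 * Qpow 3 x

/-- The test function `F`, equal to `P` on the simplex and `0` elsewhere. -/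
noncomputable def F5 (x : Fin 5 → ℝ) : ℝ :=
  if (∀ i, 0 ≤ x i) ∧ (∑ i, x i) ≤ 1 then Ppoly x else 0

open MeasureTheory Set

/-- The solid simplex `{y ≥ 0, ∑ y ≤ u}` in `ℝⁿ`. -/
def solidSimplex (n : ℕ) (u : ℝ) : Set (Fin n → ℝ) := {y | (∀ i, 0 ≤ y i) ∧ ∑ i, y i ≤ u}

theorem isCompact_solidSimplex (n : ℕ) (u : ℝ) : IsCompact (solidSimplex n u) := by
  have hb : IsCompact (Set.univ.pi fun _ : Fin n => Icc (0 : ℝ) u) :=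
    isCompact_univ_pi fun _ => isCompact_Icc
  refine hb.of_isClosed_subset ?_ ?_
  · have : solidSimplex n u = (⋂ i, {y : Fin n → ℝ | 0 ≤ y i}) ∩ {y | ∑ i, y i ≤ u} := by
      ext y; simp [solidSimplex]
    rw [this]
    exact (isClosed_iInter fun i => isClosed_le continuous_const (continuous_apply i)).inter
      (isClosed_le (by fun_prop) continuous_const)
  · intro y hy i _
    exact ⟨hy.1 i, (Finset.single_le_sum (fun j _ => hy.1 j) (Finset.mem_univ i)).trans hy.2⟩

theorem measurableSet_solidSimplex (n : ℕ) (u : ℝ) : MeasurableSet (solidSimplex n u) :=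
  (isCompact_solidSimplex n u).isClosed.measurableSet

theorem integrableOn_solidSimplex {n : ℕ} (u : ℝ) {f : (Fin n → ℝ) → ℝ} (hf : Continuous f) :
    IntegrableOn f (solidSimplex n u) :=
  hf.continuousOn.integrableOn_compact (isCompact_solidSimplex n u)

theorem insertNth_mem_solidSimplex {n : ℕ} {u s : ℝ} {y : Fin n → ℝ} (m : Fin (n + 1)) :
    (m.insertNth s y : Fin (n + 1) → ℝ) ∈ solidSimplex (n + 1) u ↔
      0 ≤ s ∧ y ∈ solidSimplex n (u - s) := by
  simp only [solidSimplex, mem_ofPred_eq, Fin.forall_iff_succAbove m, Fin.sum_univ_succAbove _ m,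
    Fin.insertNth_apply_same, Fin.insertNth_apply_succAbove, le_sub_iff_add_le', and_assoc]

theorem solidSimplex_eq_empty {n : ℕ} {u : ℝ} (hu : u < 0) : solidSimplex n u = ∅ := by
  refine eq_empty_of_forall_notMem fun y hy => ?_
  have := Finset.sum_nonneg fun i (_ : i ∈ Finset.univ) => hy.1 i
  linarith [hy.2]

theorem integrable_indicator_insertNth {n : ℕ} (u : ℝ) (m : Fin (n + 1))
    {f : (Fin (n + 1) → ℝ) → ℝ} (hf : Continuous f) :
    Integrable (fun z : ℝ × (Fin n → ℝ) =>
      (solidSimplex (n + 1) u).indicator f (m.insertNth z.1 z.2)) := by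
  have h := (volume_preserving_piFinSuccAbove (fun _ : Fin (n + 1) => ℝ) m).symm
    |>.integrable_comp_emb (MeasurableEquiv.measurableEmbedding _)
    (g := (solidSimplex (n + 1) u).indicator f)
  exact h.2 ((integrable_indicator_iff (measurableSet_solidSimplex _ _)).2
    (integrableOn_solidSimplex u hf))

theorem setIntegral_solidSimplex_eq {n : ℕ} (u : ℝ) (m : Fin (n + 1))
    (f : (Fin (n + 1) → ℝ) → ℝ) :
    ∫ x in solidSimplex (n + 1) u, f x =
      ∫ z : ℝ × (Fin n → ℝ), (solidSimplex (n + 1) u).indicator f (m.insertNth z.1 z.2) := by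
  rw [← integral_indicator (measurableSet_solidSimplex _ _)]
  exact (((volume_preserving_piFinSuccAbove (fun _ : Fin (n + 1) => ℝ) m).symm).integral_comp
    (MeasurableEquiv.measurableEmbedding _) _).symm

theorem setIntegral_solidSimplex_succ {n : ℕ} {u : ℝ} (hu : 0 ≤ u) (m : Fin (n + 1))
    {f : (Fin (n + 1) → ℝ) → ℝ} (hf : Continuous f) :
    ∫ x in solidSimplex (n + 1) u, f x =
      ∫ s in (0 : ℝ)..u, ∫ y in solidSimplex n (u - s), f (m.insertNth s y) := by
  rw [setIntegral_solidSimplex_eq u m, Measure.volume_eq_prod,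
    integral_prod _ (integrable_indicator_insertNth u m hf), intervalIntegral.integral_of_le hu,
    ← integral_Icc_eq_integral_Ioc, ← integral_indicator measurableSet_Icc]
  refine integral_congr_ae (Filter.Eventually.of_forall fun s => ?_)
  by_cases hs : s ∈ Icc 0 u
  · simp only [indicator_of_mem hs]
    rw [← integral_indicator (measurableSet_solidSimplex _ _)]
    refine integral_congr_ae (Filter.Eventually.of_forall fun y => ?_)
    simp [indicator, insertNth_mem_solidSimplex, hs.1]
  · simp only [indicator_of_notMem hs]
    refine integral_eq_zero_of_ae (Filter.Eventually.of_forall fun y => ?_)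
    refine indicator_of_notMem (fun h => hs ?_) _
    obtain ⟨h0, h1⟩ := (insertNth_mem_solidSimplex m).1 h
    refine ⟨h0, ?_⟩
    by_contra! h2
    rw [solidSimplex_eq_empty (sub_neg.2 h2)] at h1
    exact h1

theorem setIntegral_solidSimplex_succ' {n : ℕ} (u : ℝ) (m : Fin (n + 1))
    {f : (Fin (n + 1) → ℝ) → ℝ} (hf : Continuous f) :
    ∫ x in solidSimplex (n + 1) u, f x =
      ∫ y in solidSimplex n u, ∫ s in (0 : ℝ)..(u - ∑ i, y i), f (m.insertNth s y) := by
  rw [setIntegral_solidSimplex_eq u m, Measure.volume_eq_prod,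
    integral_prod_symm _ (integrable_indicator_insertNth u m hf),
    ← integral_indicator (measurableSet_solidSimplex _ _)]
  refine integral_congr_ae (Filter.Eventually.of_forall fun y => ?_)
  by_cases hy : y ∈ solidSimplex n u
  · simp only [indicator_of_mem hy]
    rw [intervalIntegral.integral_of_le (sub_nonneg.2 hy.2), ← integral_Icc_eq_integral_Ioc,
      ← integral_indicator measurableSet_Icc]
    refine integral_congr_ae (Filter.Eventually.of_forall fun s => ?_)
    simp only [indicator, insertNth_mem_solidSimplex]
    congr 1
    simp only [solidSimplex, mem_ofPred_eq, mem_Icc, eq_iff_iff]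
    exact ⟨fun h => ⟨h.1, by linarith [h.2.2]⟩, fun h => ⟨h.1, hy.1, by linarith [h.2]⟩⟩
  · simp only [indicator_of_notMem hy]
    refine integral_eq_zero_of_ae (Filter.Eventually.of_forall fun s => ?_)
    refine indicator_of_notMem (fun h => hy ?_) _
    obtain ⟨h0, h1⟩ := (insertNth_mem_solidSimplex m).1 h
    exact ⟨h1.1, by linarith [h1.2]⟩

theorem integral_pow_mul_sub_pow (a b : ℕ) (u : ℝ) :
    ∫ s in (0 : ℝ)..u, s ^ a * (u - s) ^ b =
      a.factorial * b.factorial / (a + b + 1).factorial * u ^ (a + b + 1) := by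
  induction a generalizing b with
  | zero =>
    have h := intervalIntegral.integral_comp_sub_left (a := 0) (b := u) (fun x : ℝ => x ^ b) u
    simp only [pow_zero, one_mul, h, sub_self, sub_zero, integral_pow, Nat.factorial, zero_add]
    have : ((b.factorial : ℕ) : ℝ) ≠ 0 := by positivity
    push_cast
    rw [zero_pow (by omega)]
    field_simp
    ring
  | succ a ih =>
    have hd : ∀ s ∈ uIcc 0 u, HasDerivAt (fun s : ℝ => s ^ (a + 1) * (u - s) ^ (b + 1))
        ((a + 1) * (s ^ a * (u - s) ^ (b + 1)) - (b + 1) * (s ^ (a + 1) * (u - s) ^ b)) s := by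
      intro s _
      convert! (hasDerivAt_pow (a + 1) s).mul (((hasDerivAt_id s).const_sub u).pow (b + 1)) using 1
      simp
      ring
    have h := intervalIntegral.integral_eq_sub_of_hasDerivAt hd
      (Continuous.intervalIntegrable (by fun_prop) _ _)
    rw [intervalIntegral.integral_sub (Continuous.intervalIntegrable (by fun_prop) _ _)
      (Continuous.intervalIntegrable (by fun_prop) _ _), intervalIntegral.integral_const_mul,
      intervalIntegral.integral_const_mul, ih] at h
    simp only [sub_self, ne_eq, Nat.add_eq_zero_iff, one_ne_zero, and_false, not_false_eq_true,
      zero_pow, mul_zero, zero_mul] at h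
    have hb : ((b : ℝ) + 1) ≠ 0 := by positivity
    rw [← mul_right_inj' hb, ← sub_eq_zero.1 h, show a + 1 + b + 1 = a + (b + 1) + 1 by ring,
      Nat.factorial_succ a, Nat.factorial_succ b]
    push_cast
    ring

theorem setIntegral_solidSimplex_monomial (n : ℕ) (a : Fin n → ℕ) (b : ℕ) {u : ℝ} (hu : 0 ≤ u) :
    ∫ y in solidSimplex n u, (∏ i, y i ^ a i) * (u - ∑ i, y i) ^ b =
      (∏ i, ((a i).factorial : ℝ)) * b.factorial / (∑ i, a i + b + n).factorial *
        u ^ (∑ i, a i + b + n) := by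
  induction n generalizing b u with
  | zero =>
    have h : solidSimplex 0 u = univ := by ext y; simp [solidSimplex, hu]
    have : ((b.factorial : ℕ) : ℝ) ≠ 0 := by positivity
    have hv : (volume : Measure (Fin 0 → ℝ)).real univ = 1 := by
      rw [Measure.volume_pi_eq_dirac 0]; simp
    simp [h, hv, this]
  | succ n ih =>
    rw [setIntegral_solidSimplex_succ hu 0 (by fun_prop)]
    simp only [Fin.prod_univ_succAbove _ 0, Fin.sum_univ_succAbove _ 0, Fin.insertNth_apply_same,
      Fin.insertNth_apply_succAbove]
    set N := ∑ i, a (Fin.succAbove 0 i) + b + n with hN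
    set p : ℝ := ∏ i, ((a (Fin.succAbove 0 i)).factorial : ℝ) with hp
    have key : ∀ s ∈ uIcc 0 u, (∫ y in solidSimplex n (u - s),
        (s ^ a 0 * ∏ i, y i ^ a (Fin.succAbove 0 i)) * (u - (s + ∑ i, y i)) ^ b) =
        (p * b.factorial / N.factorial) * (s ^ a 0 * (u - s) ^ N) := by
      intro s hs
      rw [uIcc_of_le hu] at hs
      have h := ih (fun i => a (Fin.succAbove 0 i)) b (sub_nonneg.2 hs.2)
      simp only [← hN, ← hp] at h
      simp only [mul_assoc, ← sub_sub, integral_const_mul, h]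
      ring
    rw [intervalIntegral.integral_congr key, intervalIntegral.integral_const_mul,
      integral_pow_mul_sub_pow, show a 0 + ∑ i, a (Fin.succAbove 0 i) + b + (n + 1) = a 0 + N + 1 by
        omega]
    have : ((N.factorial : ℕ) : ℝ) ≠ 0 := by positivity
    field_simp

theorem setIntegral_solidSimplex_powerSums (p q b : ℕ) {u : ℝ} (hu : 0 ≤ u) :
    ∫ y in solidSimplex 4 u, (∑ i, y i ^ p) * (∑ i, y i ^ q) * (u - ∑ i, y i) ^ b =
      (4 * (p + q).factorial + 12 * (p.factorial * q.factorial)) * b.factorial /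
        (p + q + b + 4).factorial * u ^ (p + q + b + 4) := by
  have h : ∀ i j : Fin 4, ∫ y in solidSimplex 4 u, y i ^ p * y j ^ q * (u - ∑ i, y i) ^ b =
      (∏ k, (((Pi.single i p + Pi.single j q : Fin 4 → ℕ) k).factorial : ℝ)) * (b.factorial /
        (p + q + b + 4).factorial * u ^ (p + q + b + 4)) := by
    intro i j
    have h1 := setIntegral_solidSimplex_monomial 4 (Pi.single i p + Pi.single j q) b hu
    have h2 : ∑ k, (Pi.single i p + Pi.single j q : Fin 4 → ℕ) k = p + q := by
      simp [Finset.sum_add_distrib]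
    have h3 : ∀ y : Fin 4 → ℝ, ∏ k, y k ^ (Pi.single i p + Pi.single j q : Fin 4 → ℕ) k =
        y i ^ p * y j ^ q := by
      intro y
      simp only [Pi.add_apply, pow_add, Finset.prod_mul_distrib]
      simp [Pi.single_apply, pow_ite]
    rw [h2] at h1
    simp only [h3] at h1
    rw [h1]
    ring
  have hs : ∀ y : Fin 4 → ℝ, (∑ i, y i ^ p) * (∑ i, y i ^ q) * (u - ∑ i, y i) ^ b =
      ∑ i, ∑ j, y i ^ p * y j ^ q * (u - ∑ i, y i) ^ b := by
    intro y
    simp only [Finset.sum_mul_sum, ← Finset.sum_mul]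
  simp only [hs]
  rw [integral_finsetSum _ fun i _ => integrableOn_solidSimplex u (by fun_prop)]
  have hj : ∀ i : Fin 4, ∫ y in solidSimplex 4 u, ∑ j, y i ^ p * y j ^ q * (u - ∑ i, y i) ^ b =
      ∑ j, ∫ y in solidSimplex 4 u, y i ^ p * y j ^ q * (u - ∑ i, y i) ^ b := fun i =>
    integral_finsetSum _ fun j _ => integrableOn_solidSimplex u (by fun_prop)
  simp only [hj, h]
  simp only [← Finset.sum_mul]
  rw [mul_div_assoc, mul_assoc]
  congr 1
  simp [Fin.sum_univ_four, Fin.prod_univ_four, Pi.single_apply]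
  ring

theorem setIntegral_solidSimplex_quadratic {N : ℕ} (k : Fin 6 → Fin N → ℝ) {u : ℝ} (hu : 0 ≤ u) :
    ∫ y in solidSimplex 4 u, ∑ b : Fin N, (k 0 b + k 1 b * ∑ i, y i ^ 2 + k 2 b * ∑ i, y i ^ 3
        + k 3 b * (∑ i, y i ^ 2) ^ 2 + k 4 b * ((∑ i, y i ^ 2) * ∑ i, y i ^ 3)
        + k 5 b * (∑ i, y i ^ 3) ^ 2) * (u - ∑ i, y i) ^ (b : ℕ) =
      ∑ b : Fin N, (b : ℕ).factorial * (k 0 b * u ^ (b + 4 : ℕ) / (b + 4 : ℕ).factorial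
        + 8 * k 1 b * u ^ (b + 6 : ℕ) / (b + 6 : ℕ).factorial
        + 24 * k 2 b * u ^ (b + 7 : ℕ) / (b + 7 : ℕ).factorial
        + 144 * k 3 b * u ^ (b + 8 : ℕ) / (b + 8 : ℕ).factorial
        + 624 * k 4 b * u ^ (b + 9 : ℕ) / (b + 9 : ℕ).factorial
        + 3312 * k 5 b * u ^ (b + 10 : ℕ) / (b + 10 : ℕ).factorial) := by
  rw [integral_finsetSum _ fun b _ => integrableOn_solidSimplex u (by fun_prop)]
  refine Finset.sum_congr rfl fun b _ => ?_
  have h := fun p q => setIntegral_solidSimplex_powerSums p q (b : ℕ) hu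
  set g : ℕ → ℕ → (Fin 4 → ℝ) → ℝ := fun p q y =>
    (∑ i, y i ^ p) * (∑ i, y i ^ q) * (u - ∑ i, y i) ^ (b : ℕ) with hg
  have he : ∀ y : Fin 4 → ℝ, (k 0 b + k 1 b * ∑ i, y i ^ 2 + k 2 b * ∑ i, y i ^ 3
        + k 3 b * (∑ i, y i ^ 2) ^ 2 + k 4 b * ((∑ i, y i ^ 2) * ∑ i, y i ^ 3)
        + k 5 b * (∑ i, y i ^ 3) ^ 2) * (u - ∑ i, y i) ^ (b : ℕ) =
      k 0 b / 16 * g 0 0 y + k 1 b / 4 * g 2 0 y + k 2 b / 4 * g 3 0 y + k 3 b * g 2 2 y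
        + k 4 b * g 2 3 y + k 5 b * g 3 3 y := by
    intro y
    simp only [hg, pow_zero, Finset.sum_const, Finset.card_univ, Fintype.card_fin, nsmul_eq_mul]
    push_cast
    ring
  simp only [he]
  have hadd : ∀ f g : (Fin 4 → ℝ) → ℝ, Continuous f → Continuous g →
      ∫ y in solidSimplex 4 u, (f y + g y) =
        (∫ y in solidSimplex 4 u, f y) + ∫ y in solidSimplex 4 u, g y := fun f g hf hg =>
    integral_add (integrableOn_solidSimplex u hf) (integrableOn_solidSimplex u hg)
  have hc : ∀ p q, Continuous (g p q) := fun p q => by simp only [hg]; fun_prop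
  rw [hadd _ _ (by fun_prop) (by fun_prop), hadd _ _ (by fun_prop) (by fun_prop),
    hadd _ _ (by fun_prop) (by fun_prop), hadd _ _ (by fun_prop) (by fun_prop),
    hadd _ _ (by fun_prop) (by fun_prop)]
  simp only [integral_const_mul, hg, h]
  rw [show 0 + 0 + (b : ℕ) + 4 = b + 4 by ring, show 2 + 0 + (b : ℕ) + 4 = b + 6 by ring,
    show 3 + 0 + (b : ℕ) + 4 = b + 7 by ring, show 2 + 2 + (b : ℕ) + 4 = b + 8 by ring,
    show 2 + 3 + (b : ℕ) + 4 = b + 9 by ring, show 3 + 3 + (b : ℕ) + 4 = b + 10 by ring]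
  norm_num [Nat.factorial_succ 5, Nat.factorial_succ 4, Nat.factorial_succ 3, Nat.factorial_succ 2,
    Nat.factorial_succ 1]
  ring

theorem mem_unitBox {k : ℕ} {x : Fin k → ℝ} : x ∈ unitBox k ↔ ∀ i, x i ∈ Icc (0 : ℝ) 1 := by
  rw [unitBox, mem_univ_pi]

theorem solidSimplex_subset_unitBox {k : ℕ} {u : ℝ} (hu : u ≤ 1) :
    solidSimplex k u ⊆ unitBox k := fun _ hy => mem_unitBox.2 fun i =>
  ⟨hy.1 i, ((Finset.single_le_sum (fun j _ => hy.1 j) (Finset.mem_univ i)).trans hy.2).trans hu⟩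

theorem solidSimplex_mono {k : ℕ} {u v : ℝ} (h : u ≤ v) : solidSimplex k u ⊆ solidSimplex k v :=
  fun _ hy => ⟨hy.1, hy.2.trans h⟩

theorem setIntegral_unitBox_removeNth {k : ℕ} (m : Fin (k + 1)) (f : (Fin k → ℝ) → ℝ) :
    ∫ x in unitBox (k + 1), f (m.removeNth x) = ∫ y in unitBox k, f y := by
  have h := (volume_preserving_piFinSuccAbove (fun _ : Fin (k + 1) => ℝ) m).setIntegral_preimage_emb
    (MeasurableEquiv.measurableEmbedding _) (fun z => f z.2) (Icc (0 : ℝ) 1 ×ˢ unitBox k)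
  have hs : (MeasurableEquiv.piFinSuccAbove (fun _ : Fin (k + 1) => ℝ) m) ⁻¹'
      (Icc (0 : ℝ) 1 ×ˢ unitBox k) = unitBox (k + 1) := by
    ext x
    simp only [mem_preimage, mem_prod, mem_unitBox, Fin.forall_iff_succAbove m]
    rfl
  rw [hs] at h
  refine Eq.trans h ?_
  have h2 := setIntegral_prod_mul (μ := (volume : Measure ℝ)) (ν := (volume : Measure (Fin k → ℝ)))
    (fun _ => (1 : ℝ)) f (Icc 0 1) (unitBox k)
  simpa [Measure.volume_eq_prod] using h2

theorem setIntegral_unitBox_indicator {k : ℕ} {u : ℝ} (hu : u ≤ 1) (f : (Fin k → ℝ) → ℝ) :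
    ∫ x in unitBox k, (solidSimplex k u).indicator f x = ∫ x in solidSimplex k u, f x := by
  rw [setIntegral_indicator (measurableSet_solidSimplex _ _),
    inter_eq_right.2 (solidSimplex_subset_unitBox hu)]

/-- The polynomial `Ppoly` in one variable `s`, given the power sums `a`, `b`, `c` of the
remaining four variables. -/
noncomputable def fiberPoly (s a b c : ℝ) : ℝ :=
  1 + 917 / 500 * (s + a) - 281 / 50 * (s + a) ^ 2 - 41 / 25 * (s ^ 2 + b)
    + 287 / 100 * (s + a) ^ 3 + 191 / 100 * (s + a) * (s ^ 2 + b) - 81 / 250 * (s ^ 3 + c)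

/-- A primitive of `fiberPoly` in `s`. -/
noncomputable def fiberPrim (s a b c : ℝ) : ℝ :=
  s + 917 / 500 * (s + a) ^ 2 / 2 - 281 / 50 * (s + a) ^ 3 / 3 - 41 / 25 * (s ^ 3 / 3 + b * s)
    + 287 / 100 * (s + a) ^ 4 / 4
    + 191 / 100 * (s ^ 4 / 4 + a * s ^ 3 / 3 + b * s ^ 2 / 2 + a * b * s)
    - 81 / 250 * (s ^ 4 / 4 + c * s)

theorem hasDerivAt_fiberPrim (s a b c : ℝ) :
    HasDerivAt (fun s => fiberPrim s a b c) (fiberPoly s a b c) s := by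
  have hs := hasDerivAt_id' s
  have ha := hs.add_const a
  have h := ((((((hs.add (((ha.pow 2).const_mul (917 / 500)).div_const 2)).sub
    (((ha.pow 3).const_mul (281 / 50)).div_const 3)).sub
    ((((hs.pow 3).div_const 3).add (hs.const_mul b)).const_mul (41 / 25))).add
    (((ha.pow 4).const_mul (287 / 100)).div_const 4)).add
    ((((((hs.pow 4).div_const 4).add (((hs.pow 3).const_mul a).div_const 3)).add
      (((hs.pow 2).const_mul b).div_const 2)).add (hs.const_mul (a * b))).const_mul
        (191 / 100))).sub
    ((((hs.pow 4).div_const 4).add (hs.const_mul c)).const_mul (81 / 250)))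
  convert! h using 1
  simp only [fiberPoly]
  push_cast
  ring

theorem integral_fiberPoly (t r a b c : ℝ) :
    ∫ s in t..r, fiberPoly s a b c = fiberPrim r a b c - fiberPrim t a b c :=
  intervalIntegral.integral_eq_sub_of_hasDerivAt (fun s _ => hasDerivAt_fiberPrim s a b c)
    (Continuous.intervalIntegrable (by unfold fiberPoly; fun_prop) _ _)

theorem F5_eq_indicator : F5 = (solidSimplex 5 1).indicator Ppoly := by
  ext x
  simp only [F5, indicator, solidSimplex, mem_ofPred_eq]
  congr

theorem Ppoly_insertNth (m : Fin 5) (s : ℝ) (y : Fin 4 → ℝ) :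
    Ppoly (m.insertNth s y) = fiberPoly s (∑ i, y i) (∑ i, y i ^ 2) (∑ i, y i ^ 3) := by
  simp [Ppoly, Qpow, fiberPoly, Fin.sum_univ_succAbove _ m]

/-- The integral of `Ppoly` over the part `t ≤ s ≤ 1 - ∑ y` of the fibre over `y`. -/
noncomputable def fiberTail (t : ℝ) (y : Fin 4 → ℝ) : ℝ :=
  fiberPrim (1 - ∑ i, y i) (∑ i, y i) (∑ i, y i ^ 2) (∑ i, y i ^ 3)
    - fiberPrim t (∑ i, y i) (∑ i, y i ^ 2) (∑ i, y i ^ 3)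

theorem integral_F5_insertNth (m : Fin 5) {t : ℝ} (ht : 0 ≤ t) (ht1 : t ≤ 1) (y : Fin 4 → ℝ) :
    ∫ s in t..1, F5 (m.insertNth s y) = (solidSimplex 4 (1 - t)).indicator (fiberTail t) y := by
  rw [F5_eq_indicator]
  by_cases hy : y ∈ solidSimplex 4 (1 - t)
  · have hr : t ≤ 1 - ∑ i, y i := by linarith [hy.2]
    have hr1 : 1 - ∑ i, y i ≤ 1 := by
      linarith [Finset.sum_nonneg fun i (_ : i ∈ Finset.univ) => hy.1 i]
    rw [indicator_of_mem hy, fiberTail, ← integral_fiberPoly, intervalIntegral.integral_of_le hr,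
      intervalIntegral.integral_of_le ht1,
      show Ioc t (1 - ∑ i, y i) = Ioc t 1 ∩ Iic (1 - ∑ i, y i) by
        rw [Ioc_inter_Iic, min_eq_right hr1],
      ← setIntegral_indicator measurableSet_Iic]
    refine setIntegral_congr_fun measurableSet_Ioc fun s hs => ?_
    simp only [indicator, insertNth_mem_solidSimplex, Ppoly_insertNth, mem_Iic]
    congr 1
    simp only [solidSimplex, mem_ofPred_eq, eq_iff_iff]
    exact ⟨fun h => by linarith [h.2.2], fun h => ⟨by linarith [hs.1], hy.1, by linarith⟩⟩
  · rw [indicator_of_notMem hy, intervalIntegral.integral_of_le ht1]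
    refine (setIntegral_congr_fun measurableSet_Ioc fun s hs => ?_).trans
      (integral_zero _ _)
    refine indicator_of_notMem (fun h => hy ?_) _
    have h1 := ((insertNth_mem_solidSimplex m).1 h).2
    exact ⟨h1.1, by linarith [h1.2, hs.1]⟩

theorem integral_F5_update (m : Fin 5) (x : Fin 5 → ℝ) :
    ∫ s in (0 : ℝ)..1, F5 (Function.update x m s) =
      (solidSimplex 4 1).indicator (fiberTail 0) (m.removeNth x) := by
  have h := integral_F5_insertNth m le_rfl zero_le_one (m.removeNth x)
  simpa only [Fin.insertNth_removeNth, sub_zero] using h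

theorem integral_Fmod_update (m : Fin 5) {ξ : ℝ} (h0 : 0 ≤ ξ) (h1 : ξ < 1 / 2) (x : Fin 5 → ℝ) :
    ∫ s in (0 : ℝ)..1, Fmod 5 (1 / 2) m F5 ξ (Function.update x m s) =
      (1 - 2 * ξ)⁻¹ * (solidSimplex 4 (1 - 2 * ξ)).indicator (fiberTail (2 * ξ))
        (m.removeNth x) := by
  have h := intervalIntegral.integral_comp_add_mul (a := 0) (b := 1) (c := 1 - 2 * ξ)
    (fun s => F5 (m.insertNth s (m.removeNth x))) (by linarith) (2 * ξ)
  rw [mul_zero, add_zero, mul_one, show 2 * ξ + (1 - 2 * ξ) = 1 by ring,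
    integral_F5_insertNth m (by linarith) (by linarith), smul_eq_mul] at h
  rw [← h]
  refine intervalIntegral.integral_congr fun s _ => ?_
  simp only [Fmod, Fin.insertNth_removeNth, Function.update_idem, Function.update_self]
  congr 2
  ring

theorem Mbrk_eq (m : Fin 5) {ξ : ℝ} (h0 : 0 ≤ ξ) (h1 : ξ < 1 / 2) :
    Mbrk 5 (1 / 2) m F5 ξ =
      ((1 - 2 * ξ)⁻¹) ^ 2 * ∫ y in solidSimplex 4 (1 - 2 * ξ), fiberTail (2 * ξ) y ^ 2 := by
  simp only [Mbrk, integral_Fmod_update m h0 h1, mul_pow, integral_const_mul]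
  rw [setIntegral_unitBox_removeNth m fun y =>
    (solidSimplex 4 (1 - 2 * ξ)).indicator (fiberTail (2 * ξ)) y ^ 2,
    ← setIntegral_unitBox_indicator (by linarith)]
  congr 2
  ext y
  by_cases hy : y ∈ solidSimplex 4 (1 - 2 * ξ) <;> simp [hy]

theorem Lbrk_eq (m : Fin 5) {ξ : ℝ} (h0 : 0 ≤ ξ) (h1 : ξ < 1 / 2) :
    Lbrk 5 (1 / 2) m F5 ξ = (1 - 2 * ξ)⁻¹ *
      ∫ y in solidSimplex 4 (1 - 2 * ξ), fiberTail (2 * ξ) y * fiberTail 0 y := by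
  simp only [Lbrk, integral_Fmod_update m h0 h1, integral_F5_update, mul_assoc, integral_const_mul]
  rw [setIntegral_unitBox_removeNth m fun y =>
    (solidSimplex 4 (1 - 2 * ξ)).indicator (fiberTail (2 * ξ)) y *
      (solidSimplex 4 1).indicator (fiberTail 0) y,
    ← setIntegral_unitBox_indicator (by linarith)]
  congr 2
  ext y
  by_cases hy : y ∈ solidSimplex 4 (1 - 2 * ξ)
  · have hy' : y ∈ solidSimplex 4 1 := solidSimplex_mono (by linarith) hy
    simp [hy, hy']
  · simp [hy]

theorem Jk_eq (m : Fin 5) : Jk 5 m F5 = ∫ y in solidSimplex 4 1, fiberTail 0 y ^ 2 := by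
  simp only [Jk, integral_F5_update]
  rw [setIntegral_unitBox_removeNth m fun y =>
    (solidSimplex 4 1).indicator (fiberTail 0) y ^ 2, ← setIntegral_unitBox_indicator le_rfl]
  congr 1
  ext y
  by_cases hy : y ∈ solidSimplex 4 1 <;> simp [hy]

theorem Ik_eq : Ik 5 F5 = ∫ y in solidSimplex 4 1, ∫ s in (0 : ℝ)..(1 - ∑ i, y i),
    fiberPoly s (∑ i, y i) (∑ i, y i ^ 2) (∑ i, y i ^ 3) ^ 2 := by
  have h : ∀ x, F5 x ^ 2 = (solidSimplex 5 1).indicator (fun x => Ppoly x ^ 2) x := by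
    intro x
    rw [F5_eq_indicator]
    by_cases hx : x ∈ solidSimplex 5 1 <;> simp [hx]
  simp only [Ik, h]
  rw [setIntegral_unitBox_indicator le_rfl, setIntegral_solidSimplex_succ' 1 0
    (by unfold Ppoly Qpow; fun_prop)]
  simp only [Ppoly_insertNth]

/-- The value of `∫ fiberTail t * fiberTail 0` over the simplex of size `u = 1 - t`. -/
noncomputable def tailCorrelation (u : ℝ) : ℝ :=
  611 / 4000000 * u ^ 5 + 100331 / 120000000 * u ^ 6 + 134251 / 236250000 * u ^ 7 - 1774279 /
  604800000 * u ^ 8 + 165794887 / 68040000000 * u ^ 9 - 30344831 / 45360000000 * u ^ 10 - 17459461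
  / 623700000000 * u ^ 11 + 1079627 / 46777500000 * u ^ 12

/-- The value of `∫ fiberTail t ^ 2` over the simplex of size `u = 1 - t`. -/
noncomputable def tailEnergy (u : ℝ) : ℝ :=
  1 / 400000 * u ^ 6 + 47 / 2800000 * u ^ 7 + 267937 / 1680000000 * u ^ 8 - 54739 / 472500000 * u
  ^ 9 + 69473209 / 56700000000 * u ^ 10 - 749569493 / 623700000000 * u ^ 11 + 320636803 /
  1069200000000 * u ^ 12

theorem integral_fiberTail_mul {u : ℝ} (hu : 0 ≤ u) :
    ∫ y in solidSimplex 4 u, fiberTail (1 - u) y * fiberTail 0 y = tailCorrelation u := by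
  have h := setIntegral_solidSimplex_quadratic
    ![![0, 1833 / 100000 + 15917 / 62500 * u - 312597 / 500000 * u ^ 2 - 20229 / 50000 * u ^ 3 +
    252223 / 100000 * u ^ 4 - 47133 / 15625 * u ^ 5 + 780669 / 500000 * u ^ 6 - 77571 / 250000 * u
    ^ 7, -463023 / 1000000 + 1570469 / 750000 * u + 3796543 / 3000000 * u ^ 2 - 2512847 / 187500 *
    u ^ 3 + 11821889 / 600000 * u ^ 4 - 8858869 / 750000 * u ^ 5 + 7863401 / 3000000 * u ^ 6,
    -337153 / 1500000 - 1263567 / 500000 * u + 9501599 / 450000 * u ^ 2 - 30808861 / 750000 * u ^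
    3 + 9325283 / 300000 * u ^ 4 - 37357619 / 4500000 * u ^ 5, 2956637 / 3000000 - 1654889 /
    140625 * u + 18753853 / 500000 * u ^ 2 - 15188411 / 375000 * u ^ 3 + 127064171 / 9000000 * u ^
    4, 6898751 / 4500000 - 11632501 / 750000 * u + 44549717 / 1500000 * u ^ 2 - 16896113 / 1125000
    * u ^ 3, 7182421 / 3000000 - 9403757 / 750000 * u + 95064697 / 9000000 * u ^ 2, 3760757 /
    1500000 - 20648251 / 4500000 * u, 8254129 / 9000000], ![0, 7221 / 50000 - 1032 / 3125 * u +
    29847 / 50000 * u ^ 2 - 10449 / 10000 * u ^ 3 + 1179 / 1250 * u ^ 4 - 15471 / 50000 * u ^ 5,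
    -123 / 6250 - 171389 / 75000 * u + 387839 / 50000 * u ^ 2 - 207903 / 25000 * u ^ 3 + 87287 /
    30000 * u ^ 4, 22019 / 75000 - 1258429 / 150000 * u + 2368181 / 150000 * u ^ 2 - 572809 /
    75000 * u ^ 3, 732221 / 300000 - 229259 / 18750 * u + 961303 / 100000 * u ^ 2, 571829 / 150000
    - 96073 / 15000 * u, 548743 / 300000, 0, 0], ![0, -51921 / 250000 - 3753 / 125000 * u + 130491
    / 125000 * u ^ 2 - 30537 / 25000 * u ^ 3 + 20763 / 50000 * u ^ 4, 35127 / 250000 - 647433 /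
    250000 * u + 1051947 / 250000 * u ^ 2 - 453249 / 250000 * u ^ 3, 44307 / 50000 - 236493 /
    62500 * u + 659961 / 250000 * u ^ 2, 289629 / 250000 - 465669 / 250000 * u, 77571 / 125000, 0,
    0, 0], ![0, -3699 / 20000 + 1107 / 2500 * u - 5157 / 20000 * u ^ 2, 1691 / 8000 - 2101 / 2000
    * u + 36481 / 40000 * u ^ 2, 26167 / 20000 - 36481 / 20000 * u, 36481 / 40000, 0, 0, 0, 0],
    ![0, 6723 / 50000 - 11097 / 25000 * u + 15471 / 50000 * u ^ 2, 7533 / 10000 - 46413 / 50000 *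
    u, 15471 / 25000, 0, 0, 0, 0, 0], ![0, 6561 / 62500 - 6561 / 62500 * u, 6561 / 62500, 0, 0, 0,
    0, 0, 0]] hu
  refine Eq.trans (integral_congr_ae (Filter.Eventually.of_forall fun y => ?_)) (h.trans ?_)
  · obtain ⟨ρ, hρ⟩ : ∃ ρ, ∑ i, y i = u - ρ := ⟨u - ∑ i, y i, by ring⟩
    simp only [fiberTail, fiberPrim, hρ]
    generalize ∑ i, y i ^ 2 = b
    generalize ∑ i, y i ^ 3 = c
    simp [Fin.sum_univ_succ]
    ring
  · simp [Fin.sum_univ_succ, Nat.factorial, tailCorrelation]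
    ring

theorem integral_fiberTail_sq {u : ℝ} (hu : 0 ≤ u) :
    ∫ y in solidSimplex 4 u, fiberTail (1 - u) y ^ 2 = tailEnergy u := by
  have h := setIntegral_solidSimplex_quadratic
    ![![0, 0, 9 / 10000 + 81 / 3125 * u + 18063 / 125000 * u ^ 2 - 36693 / 62500 * u ^ 3 + 38637 /
    50000 * u ^ 4 - 28431 / 62500 * u ^ 5 + 6561 / 62500 * u ^ 6, -2319 / 50000 - 31947 / 62500 *
    u + 8139 / 2500 * u ^ 2 - 676647 / 125000 * u ^ 3 + 185787 / 50000 * u ^ 4 - 116721 / 125000 *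
    u ^ 5, 605089 / 1000000 - 120989 / 31250 * u + 4851721 / 500000 * u ^ 2 - 274841 / 31250 * u ^
    3 + 2698993 / 1000000 * u ^ 4, -7883 / 31250 - 1240793 / 750000 * u + 2249983 / 375000 * u ^ 2
    - 2541907 / 750000 * u ^ 3, 2244643 / 1500000 - 892643 / 187500 * u + 16572941 / 4500000 * u ^
    2, -60333 / 250000 - 4139993 / 2250000 * u, 8254129 / 9000000], ![0, 0, 81 / 5000 + 729 / 3125
    * u - 9477 / 25000 * u ^ 2 + 2187 / 12500 * u ^ 3, -2967 / 6250 + 7317 / 12500 * u + 14067 /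
    25000 * u ^ 2 - 15471 / 25000 * u ^ 3, 154447 / 100000 - 55877 / 12500 * u + 275231 / 100000 *
    u ^ 2, -3789 / 5000 - 275231 / 150000 * u, 548743 / 300000, 0, 0], ![0, 0, -243 / 12500 - 4374
    / 15625 * u + 28431 / 62500 * u ^ 2 - 6561 / 31250 * u ^ 3, 62613 / 125000 - 52893 / 31250 * u
    + 116721 / 125000 * u ^ 2, -5103 / 62500 - 38907 / 62500 * u, 77571 / 125000, 0, 0, 0], ![0,
    0, 729 / 10000, -5157 / 10000, 36481 / 40000, 0, 0, 0, 0], ![0, 0, -2187 / 12500, 15471 /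
    25000, 0, 0, 0, 0, 0], ![0, 0, 6561 / 62500, 0, 0, 0, 0, 0, 0]] hu
  refine Eq.trans (integral_congr_ae (Filter.Eventually.of_forall fun y => ?_)) (h.trans ?_)
  · obtain ⟨ρ, hρ⟩ : ∃ ρ, ∑ i, y i = u - ρ := ⟨u - ∑ i, y i, by ring⟩
    simp only [fiberTail, fiberPrim, hρ]
    generalize ∑ i, y i ^ 2 = b
    generalize ∑ i, y i ^ 3 = c
    simp [Fin.sum_univ_succ]
    ring
  · simp [Fin.sum_univ_succ, Nat.factorial, tailEnergy]
    ring

theorem integral_sum_pow {N : ℕ} (c : Fin N → ℝ) (a b : ℝ) :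
    ∫ x in a..b, ∑ i, c i * x ^ (i : ℕ) =
      ∑ i, c i * ((b ^ (i + 1 : ℕ) - a ^ (i + 1 : ℕ)) / ((i : ℕ) + 1)) := by
  rw [intervalIntegral.integral_finsetSum fun i _ =>
    Continuous.intervalIntegrable (by fun_prop) _ _]
  simp only [intervalIntegral.integral_const_mul, integral_pow]

theorem integral_cubic_sq (f₀ f₁ f₂ f₃ r : ℝ) :
    ∫ s in (0 : ℝ)..r, (f₀ + f₁ * s + f₂ * s ^ 2 + f₃ * s ^ 3) ^ 2 =
      f₀ ^ 2 * r + f₀ * f₁ * r ^ 2 + (2 * f₀ * f₂ + f₁ ^ 2) * r ^ 3 / 3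
        + (f₀ * f₃ + f₁ * f₂) * r ^ 4 / 2 + (2 * f₁ * f₃ + f₂ ^ 2) * r ^ 5 / 5
        + f₂ * f₃ * r ^ 6 / 3 + f₃ ^ 2 * r ^ 7 / 7 := by
  have h := integral_sum_pow ![f₀ ^ 2, 2 * f₀ * f₁, 2 * f₀ * f₂ + f₁ ^ 2,
    2 * f₀ * f₃ + 2 * f₁ * f₂, 2 * f₁ * f₃ + f₂ ^ 2, 2 * f₂ * f₃, f₃ ^ 2] 0 r
  refine Eq.trans (intervalIntegral.integral_congr fun s _ => ?_) (h.trans ?_)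
  · simp [Fin.sum_univ_succ]
    ring
  · simp [Fin.sum_univ_succ]
    ring

theorem fiberPoly_eq_cubic (s a b c : ℝ) :
    fiberPoly s a b c =
      (1 + 917 / 500 * a - 281 / 50 * a ^ 2 - 41 / 25 * b + 287 / 100 * a ^ 3 + 191 / 100 * a * b
        - 81 / 250 * c)
      + (917 / 500 - 281 / 25 * a + 861 / 100 * a ^ 2 + 191 / 100 * b) * s
      + (-(363 / 50) + 263 / 25 * a) * s ^ 2 + 557 / 125 * s ^ 3 := by
  simp only [fiberPoly]
  ring

theorem Ik_value : Ik 5 F5 = 1735763 / 1732500000 := by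
  have h := setIntegral_solidSimplex_quadratic
    ![![0, 441 / 62500, 4179 / 62500, 73831 / 187500, 133119 / 125000, 3057991 / 3750000, -148709
    / 46875, 2403811 / 1750000], ![0, 567 / 12500, 681 / 12500, -4001 / 9375, -172927 / 50000,
    117083 / 46875, 0, 0], ![0, -1701 / 31250, -16119 / 62500, -4401 / 6250, 77571 / 125000, 0, 0,
    0], ![0, 729 / 10000, -5157 / 10000, 36481 / 30000, 0, 0, 0, 0], ![0, -2187 / 12500, 15471 /
    25000, 0, 0, 0, 0, 0], ![0, 6561 / 62500, 0, 0, 0, 0, 0, 0]] zero_le_one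
  rw [Ik_eq]
  refine Eq.trans (integral_congr_ae (Filter.Eventually.of_forall fun y => ?_)) (h.trans ?_)
  · obtain ⟨ρ, hρ⟩ : ∃ ρ, ∑ i, y i = 1 - ρ := ⟨1 - ∑ i, y i, by ring⟩
    simp only [fiberPoly_eq_cubic, integral_cubic_sq, hρ]
    generalize ∑ i, y i ^ 2 = b
    generalize ∑ i, y i ^ 3 = c
    simp [Fin.sum_univ_succ]
    ring
  · simp [Fin.sum_univ_succ, Nat.factorial]
    norm_num

theorem Jk_value (m : Fin 5) : Jk 5 m F5 = 722755717 / 1871100000000 := by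
  have h := integral_fiberTail_sq zero_le_one
  rw [sub_self] at h
  rw [Jk_eq, h, tailEnergy]
  norm_num

/-- `∫ (∫₀ᵗ F5 ds)² / t²`, written in the Bernstein basis. -/
noncomputable def headEnergy (t : ℝ) : ℝ :=
  62295923 / 9450000000 * t ^ 0 * (1 - t) ^ 10 + 1230127 / 25200000 * t ^ 1 * (1 - t) ^ 9 +
  2357141831 / 15120000000 * t ^ 2 * (1 - t) ^ 8 + 2725143893 / 9450000000 * t ^ 3 * (1 - t) ^ 7 +
  2860176583 / 8100000000 * t ^ 4 * (1 - t) ^ 6 + 2888135893 / 9450000000 * t ^ 5 * (1 - t) ^ 5 +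
  722755717 / 3780000000 * t ^ 6 * (1 - t) ^ 4 + 722755717 / 8505000000 * t ^ 7 * (1 - t) ^ 3 +
  722755717 / 28350000000 * t ^ 8 * (1 - t) ^ 2 + 722755717 / 155925000000 * t ^ 9 * (1 - t) ^ 1 +
  722755717 / 1871100000000 * t ^ 10 * (1 - t) ^ 0

theorem headEnergy_nonneg {t : ℝ} (h0 : 0 ≤ t) (h1 : t ≤ 1) : 0 ≤ headEnergy t := by
  have h2 : 0 ≤ 1 - t := sub_nonneg.2 h1
  unfold headEnergy
  positivity

theorem sq_mul_headEnergy (t : ℝ) :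
    722755717 / 1871100000000 - 2 * tailCorrelation (1 - t) + tailEnergy (1 - t) =
      t ^ 2 * headEnergy t := by
  unfold tailCorrelation tailEnergy headEnergy
  ring

theorem Lk_eq (m : Fin 5) {η : ℝ} (h0 : 0 < η) (h1 : η ≤ 1 / 2) :
    Lk 5 (1 / 2) η m F5 =
      ∫ ξ in η..1 / 2, (ξ * (1 - ξ))⁻¹ * (1 / 2 * tailCorrelation (1 - 2 * ξ)) := by
  refine intervalIntegral.integral_congr fun ξ hξ => ?_
  rw [uIcc_of_le h1] at hξ
  have hξ0 : ξ ≠ 0 := by linarith [hξ.1]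
  have hξ1 : 1 - ξ ≠ 0 := by linarith [hξ.2]
  rcases hξ.2.eq_or_lt with rfl | hlt
  · simp [tailCorrelation]
  · have hd : 1 - 2 * ξ ≠ 0 := by linarith
    have h := integral_fiberTail_mul (u := 1 - 2 * ξ) (by linarith)
    rw [sub_sub_cancel] at h
    simp only [Lbrk_eq m (h0.le.trans hξ.1) hlt, h]
    field_simp

theorem Mk_eq (m : Fin 5) {η : ℝ} (h0 : 0 < η) (h1 : η ≤ 1 / 2) :
    Mk 5 (1 / 2) η m F5 =
      ∫ ξ in η..1 / 2, (ξ * (1 - ξ))⁻¹ * (1 / 4 * tailEnergy (1 - 2 * ξ)) := by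
  refine intervalIntegral.integral_congr fun ξ hξ => ?_
  rw [uIcc_of_le h1] at hξ
  have hξ0 : ξ ≠ 0 := by linarith [hξ.1]
  have hξ1 : 1 - ξ ≠ 0 := by linarith [hξ.2]
  rcases hξ.2.eq_or_lt with rfl | hlt
  · simp [tailEnergy]
  · have hd : 1 - 2 * ξ ≠ 0 := by linarith
    have h := integral_fiberTail_sq (u := 1 - 2 * ξ) (by linarith)
    rw [sub_sub_cancel] at h
    simp only [Mbrk_eq m (h0.le.trans hξ.1) hlt, h]
    field_simp
    ring

theorem intervalIntegrable_inv_mul {η : ℝ} (h0 : 0 < η) (h1 : η ≤ 1 / 2) {p : ℝ → ℝ}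
    (hp : Continuous p) :
    IntervalIntegrable (fun ξ => (ξ * (1 - ξ))⁻¹ * p ξ) volume η (1 / 2) := by
  refine ContinuousOn.intervalIntegrable (ContinuousOn.mul (ContinuousOn.inv₀ (by fun_prop) ?_)
    hp.continuousOn)
  intro ξ hξ
  rw [uIcc_of_le h1] at hξ
  have hξ0 : ξ ≠ 0 := by linarith [hξ.1]
  have hξ1 : 1 - ξ ≠ 0 := by linarith [hξ.2]
  exact mul_ne_zero hξ0 hξ1

theorem log_eq_integral {η : ℝ} (h0 : 0 < η) (h1 : η ≤ 1 / 2) :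
    Real.log ((1 - η) / η) = ∫ ξ in η..1 / 2, (ξ * (1 - ξ))⁻¹ * 1 := by
  have hd : ∀ ξ ∈ uIcc η (1 / 2), HasDerivAt (fun ξ => Real.log ξ - Real.log (1 - ξ))
      ((ξ * (1 - ξ))⁻¹ * 1) ξ := by
    intro ξ hξ
    rw [uIcc_of_le h1] at hξ
    have hξ0 : ξ ≠ 0 := by linarith [hξ.1]
    have hξ1 : 1 - ξ ≠ 0 := by linarith [hξ.2]
    convert! (Real.hasDerivAt_log hξ0).sub (((hasDerivAt_id' ξ).const_sub 1).log hξ1) using 1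
    field_simp
    ring
  rw [intervalIntegral.integral_eq_sub_of_hasDerivAt hd
    (intervalIntegrable_inv_mul h0 h1 continuous_const),
    Real.log_div (by linarith) h0.ne']
  norm_num

theorem cubic_le_inv_one_sub {ξ : ℝ} (h : ξ < 1) :
    80 / 81 + 32 / 27 * ξ + 256 / 81 * ξ ^ 3 ≤ (1 - ξ)⁻¹ := by
  have h1 : 0 < 1 - ξ := sub_pos.2 h
  have h2 : (1 - ξ)⁻¹ - (80 / 81 + 32 / 27 * ξ + 256 / 81 * ξ ^ 3) =
      256 / 81 * (ξ - 1 / 4) ^ 4 * (1 - ξ)⁻¹ := by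
    field_simp
    ring
  have h3 : 0 ≤ 256 / 81 * (ξ - 1 / 4) ^ 4 * (1 - ξ)⁻¹ := by positivity
  linarith

theorem integral_lower_bound :
    1735763 / 8662500000 < ∫ ξ in (1 / 10 ^ 10 : ℝ)..1 / 2,
      ξ * headEnergy (2 * ξ) * (80 / 81 + 32 / 27 * ξ + 256 / 81 * ξ ^ 3) := by
  have h := integral_sum_pow
    ![0, 62295923 / 9568125000, -155355064 / 5980078125, 222836731 / 19136250000, 36077837 /
    253125000, -5348722606 / 17940234375, -95117053 / 1196015625, 6521949314 / 5980078125,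
    -16662892052 / 10764140625, -336024736 / 2562890625, 81215511584 / 21926953125, -107132918096
    / 16915078125, 34282879136 / 5980078125, -40425008128 / 13156171875, 14731457792 /
    17940234375]
    (1 / 10 ^ 10) (1 / 2)
  refine lt_of_lt_of_eq ?_ (h.symm.trans (intervalIntegral.integral_congr fun ξ _ => ?_))
  · simp [Fin.sum_univ_succ]
    norm_num
  · simp [Fin.sum_univ_succ, headEnergy]
    ring

/-- The key positivity from the proof of Theorem 1.4: with `k = 5`, `θ = 1`
(`θ/2 = 1/2`) and `η = 10⁻¹⁰`,
`-Σ_m L₅^{(m)}(F) + (1/4) log((1-η)/η) Σ_m J₅^{(m)}(F) + Σ_m M₅^{(m)}(F) - I₅(F) > 0`. -/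
theorem positivity_for_E2_gap_twelve :
    0 < -(∑ m : Fin 5, Lk 5 (1 / 2) (1 / 10 ^ 10) m F5)
        + 1 / 4 * Real.log ((1 - 1 / 10 ^ 10) / (1 / 10 ^ 10)) * (∑ m : Fin 5, Jk 5 m F5)
        + (∑ m : Fin 5, Mk 5 (1 / 2) (1 / 10 ^ 10) m F5) - Ik 5 F5 := by
  have h0 : (0 : ℝ) < 1 / 10 ^ 10 := by norm_num
  have h1 : (1 : ℝ) / 10 ^ 10 ≤ 1 / 2 := by norm_num
  have hcL : Continuous fun ξ : ℝ => 1 / 2 * tailCorrelation (1 - 2 * ξ) := by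
    unfold tailCorrelation; fun_prop
  have hcM : Continuous fun ξ : ℝ => 1 / 4 * tailEnergy (1 - 2 * ξ) := by
    unfold tailEnergy; fun_prop
  have hiL := intervalIntegrable_inv_mul h0 h1 hcL
  have hiM := intervalIntegrable_inv_mul h0 h1 hcM
  have hi1 := intervalIntegrable_inv_mul h0 h1 (continuous_const (y := (1 : ℝ)))
  have hb := integral_lower_bound
  have hmono := intervalIntegral.integral_mono_on h1
    (Continuous.intervalIntegrable (by unfold headEnergy; fun_prop) _ _)
    ((hi1.const_mul (1 / 4 * (722755717 / 1871100000000))).sub hiL |>.add hiM)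
    (f := fun ξ : ℝ => ξ * headEnergy (2 * ξ) * (80 / 81 + 32 / 27 * ξ + 256 / 81 * ξ ^ 3))
    fun ξ hξ => by
      have hξ0 : 0 < ξ := h0.trans_le hξ.1
      have hξ1 : 0 < 1 - ξ := by linarith [hξ.2]
      have hnn : 0 ≤ ξ * headEnergy (2 * ξ) :=
        mul_nonneg hξ0.le (headEnergy_nonneg (by linarith) (by linarith [hξ.2]))
      refine (mul_le_mul_of_nonneg_left (cubic_le_inv_one_sub (by linarith)) hnn).trans_eq ?_
      have hs := sq_mul_headEnergy (2 * ξ)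
      have hw : ξ * headEnergy (2 * ξ) * (1 - ξ)⁻¹ =
          (ξ * (1 - ξ))⁻¹ * (1 / 4 * ((2 * ξ) ^ 2 * headEnergy (2 * ξ))) := by
        field_simp
        ring
      rw [hw, ← hs]
      ring
  rw [intervalIntegral.integral_add ((hi1.const_mul _).sub hiL) hiM,
    intervalIntegral.integral_sub (hi1.const_mul _) hiL, intervalIntegral.integral_const_mul,
    ← log_eq_integral h0 h1, ← Lk_eq 0 h0 h1, ← Mk_eq 0 h0 h1] at hmono
  simp only [fun m => (Lk_eq m h0 h1).trans (Lk_eq 0 h0 h1).symm,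
    fun m => (Mk_eq m h0 h1).trans (Mk_eq 0 h0 h1).symm, Jk_value, Ik_value, Finset.sum_const,
    Finset.card_univ, Fintype.card_fin, nsmul_eq_mul]
  push_cast
  linarith
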